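/- The dimension of the Berman code Ber_n^{r}(m) over F_2 equals Σ_{w=r+1}^{m} C(m,w)(n−1)^w, and the dimension of the Dual Berman code B_n^{r}(m) equals Σ_{w=0}^{r} C(m,w)(n−1)^w. -/

import Mathlib

open scoped BigOperators

/-- The `l`-th block (of length `n^m`) of a vector of length `n^(m+1)`,
where the first coordinate of the index tuple selects the block. -/
def blockAt (n m : ℕ) (l : Fin n) (v : (Fin (m + 1) → Fin n) → ZMod 2) :
    (Fin m → Fin n) → ZMod 2 :=
  fun j => v (Fin.cons l j)

/-- Berman code `Ber_n^r(m) ⊆ F_2^{n^m}`, coordinates indexed by `H^m` with `H = Fin n`.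
`Ber_n^m(m) = {0}`, `Ber_n^0(m)` is the single parity-check code, and for `1 ≤ r`,
a codeword is a concatenation `(v_0|…|v_{n-1})` with each block in `Ber_n^{r-1}(m-1)`
and the sum of the blocks in `Ber_n^r(m-1)`. -/
def Ber (n : ℕ) : ℕ → (m : ℕ) → Set ((Fin m → Fin n) → ZMod 2)
  | _, 0 => {0}
  | 0, (m + 1) => {c | ∑ i, c i = 0}
  | (r + 1), (m + 1) =>
      {v | (∀ l : Fin n, blockAt n m l v ∈ Ber n r m) ∧
        (fun j => ∑ l : Fin n, v (Fin.cons l j)) ∈ Ber n (r + 1) m}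

/-- Dual Berman code `B_n^r(m) ⊆ F_2^{n^m}`.
`B_n^m(m)` is the full space, `B_n^0(m)` is the repetition code, and for `1 ≤ r`,
a codeword is `(u+u_0|…|u+u_{n-2}|u)` with each `u_l ∈ B_n^{r-1}(m-1)` and `u ∈ B_n^r(m-1)`. -/
def DBer (n : ℕ) : ℕ → (m : ℕ) → Set ((Fin m → Fin n) → ZMod 2)
  | _, 0 => Set.univ
  | 0, (m + 1) => {c | ∃ a : ZMod 2, c = fun _ => a}
  | (r + 1), (m + 1) =>
      {v | ∃ u ∈ DBer n (r + 1) m, ∃ w : Fin n → ((Fin m → Fin n) → ZMod 2),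
        (∀ l, w l ∈ DBer n r m) ∧
        (∀ l : Fin n, blockAt n m l v = if l.val = n - 1 then u else u + w l)}

/-- Star product of two codes: the span of all coordinatewise products. -/
def starProd {ι : Type*} (C D : Set (ι → ZMod 2)) : Submodule (ZMod 2) (ι → ZMod 2) :=
  Submodule.span (ZMod 2) {x | ∃ c ∈ C, ∃ d ∈ D, x = c * d}

/-- Dual code w.r.t. the standard bilinear form. -/
def dualCode {ι : Type*} [Fintype ι] (C : Set (ι → ZMod 2)) : Set (ι → ZMod 2) :=
  {x | ∀ c ∈ C, ∑ i, x i * c i = 0}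

/-- Partial order on tuples: `j ⪯ i` iff `supp(j) ⊆ supp(i)` and `j` agrees with `i` on
`supp(j)`. -/
def preceq {n m : ℕ} (j i : Fin m → Fin n) : Prop :=
  ∀ s, (j s).val ≠ 0 → j s = i s

instance {n m : ℕ} (j i : Fin m → Fin n) : Decidable (preceq j i) := by
  unfold preceq; infer_instance

/-- Hamming weight of a tuple in `H^m`: the number of nonzero entries. -/
def tupleWt {n m : ℕ} (j : Fin m → Fin n) : ℕ :=
  (Finset.univ.filter fun s => (j s).val ≠ 0).card

/-- The vector `c_m(i')`, the indicator of `{i : i ⪯ i'}`. -/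
def cm {n m : ℕ} (i' : Fin m → Fin n) : (Fin m → Fin n) → ZMod 2 :=
  fun i => if preceq i i' then 1 else 0

/-- The vector `d_m(i')`, the indicator of `{i : i ⪰ i'}`. -/
def dm {n m : ℕ} (i' : Fin m → Fin n) : (Fin m → Fin n) → ZMod 2 :=
  fun i => if preceq i' i then 1 else 0

/-- Standard basis vector of `F_2^{n^m}` at coordinate `v`. -/
def eVec {n m : ℕ} (v : Fin m → Fin n) : (Fin m → Fin n) → ZMod 2 :=
  fun i => if i = v then 1 else 0

/-- block as a linear map -/
def blockL (n m : ℕ) (l : Fin n) :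
    ((Fin (m + 1) → Fin n) → ZMod 2) →ₗ[ZMod 2] ((Fin m → Fin n) → ZMod 2) :=
  LinearMap.funLeft (ZMod 2) (ZMod 2) (fun j => (Fin.cons l j : Fin (m + 1) → Fin n))

theorem blockL_eq (n m : ℕ) (l : Fin n) (v) : blockL n m l v = blockAt n m l v := rfl

theorem block_ext {n m : ℕ} {v w : (Fin (m + 1) → Fin n) → ZMod 2}
    (h : ∀ l, blockL n m l v = blockL n m l w) : v = w := by
  funext j
  have := congrFun (h (j 0)) (Fin.tail j)
  simpa [blockL, LinearMap.funLeft] using this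

/-- concatenation of blocks -/
def glue (n m : ℕ) (b : Fin n → ((Fin m → Fin n) → ZMod 2)) :
    (Fin (m + 1) → Fin n) → ZMod 2 := fun j => b (j 0) (Fin.tail j)

theorem block_glue (n m : ℕ) (b) (l : Fin n) : blockL n m l (glue n m b) = b l := by
  funext j
  simp [blockL, LinearMap.funLeft, glue]

/-- total sum -/
def totL (n m : ℕ) : ((Fin m → Fin n) → ZMod 2) →ₗ[ZMod 2] ZMod 2 :=
  ∑ i, LinearMap.proj i

theorem totL_apply (n m : ℕ) (v) : totL n m v = ∑ i, v i := by
  simp [totL]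

/-- sum of blocks -/
def sumL (n m : ℕ) :
    ((Fin (m + 1) → Fin n) → ZMod 2) →ₗ[ZMod 2] ((Fin m → Fin n) → ZMod 2) :=
  ∑ l, blockL n m l

theorem sumL_apply (n m : ℕ) (v) : sumL n m v = ∑ l, blockL n m l v := by
  simp [sumL]

theorem sumL_eq (n m : ℕ) (v) : sumL n m v = fun j => ∑ l : Fin n, v (Fin.cons l j) := by
  funext j
  simp [sumL_apply, blockL, LinearMap.funLeft]

theorem totL_sumL (n m : ℕ) (v) : totL n m (sumL n m v) = totL n (m + 1) v := by
  rw [totL_apply, totL_apply, sumL_eq, ← (Fin.consEquiv (fun _ => Fin n)).sum_comp,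
    Fintype.sum_prod_type_right]
  rfl

def BerS (n : ℕ) : ℕ → (m : ℕ) → Submodule (ZMod 2) ((Fin m → Fin n) → ZMod 2)
  | _, 0 => ⊥
  | 0, (m + 1) => LinearMap.ker (totL n (m + 1))
  | (r + 1), (m + 1) =>
      (⨅ l, (BerS n r m).comap (blockL n m l)) ⊓ (BerS n (r + 1) m).comap (sumL n m)

def DBerS (k : ℕ) : ℕ → (m : ℕ) → Submodule (ZMod 2) ((Fin m → Fin (k + 1)) → ZMod 2)
  | _, 0 => ⊤
  | 0, (m + 1) => Submodule.span (ZMod 2) {fun _ => 1}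
  | (r + 1), (m + 1) =>
      (⨅ l, (DBerS k r m).comap (blockL (k + 1) m l - blockL (k + 1) m (Fin.last k))) ⊓
        (DBerS k (r + 1) m).comap (blockL (k + 1) m (Fin.last k))

theorem mem_BerS {n r m : ℕ} {v} : v ∈ BerS n (r + 1) (m + 1) ↔
    (∀ l, blockL n m l v ∈ BerS n r m) ∧ sumL n m v ∈ BerS n (r + 1) m := by
  simp [BerS]

theorem mem_DBerS {k r m : ℕ} {v} : v ∈ DBerS k (r + 1) (m + 1) ↔
    (∀ l, blockL (k + 1) m l v - blockL (k + 1) m (Fin.last k) v ∈ DBerS k r m) ∧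
      blockL (k + 1) m (Fin.last k) v ∈ DBerS k (r + 1) m := by
  simp [DBerS]

theorem BerS_coe (n : ℕ) : ∀ m r, (BerS n r m : Set _) = Ber n r m := by
  intro m
  induction m with
  | zero => intro r; cases r <;> simp [BerS, Ber]
  | succ m ih =>
    intro r
    cases r with
    | zero => ext v; simp [BerS, Ber, totL_apply]
    | succ r =>
      ext v
      rw [SetLike.mem_coe, mem_BerS, ← SetLike.mem_coe, ih, sumL_eq]
      simp only [← SetLike.mem_coe, ih]
      simp only [blockL_eq, Ber, Set.mem_setOf_eq]

theorem DBerS_coe (k : ℕ) : ∀ m r, (DBerS k r m : Set _) = DBer (k + 1) r m := by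
  intro m
  induction m with
  | zero => intro r; cases r <;> simp [DBerS, DBer]
  | succ m ih =>
    intro r
    cases r with
    | zero =>
      ext v
      simp only [DBerS, DBer, SetLike.mem_coe, Submodule.mem_span_singleton, Set.mem_setOf_eq]
      constructor
      · rintro ⟨a, rfl⟩; exact ⟨a, by funext; simp⟩
      · rintro ⟨a, rfl⟩; exact ⟨a, by funext; simp⟩
    | succ r =>
      ext v
      rw [SetLike.mem_coe, mem_DBerS]
      simp only [DBer, Set.mem_setOf_eq, ← ih, SetLike.mem_coe, ← blockL_eq]
      constructor
      · rintro ⟨h1, h2⟩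
        refine ⟨_, h2, _, h1, fun l => ?_⟩
        split_ifs with h
        · have : l = Fin.last k := Fin.ext (by simpa using h)
          rw [this]
        · abel
      · rintro ⟨u, hu, w, hw, h⟩
        have hl := h (Fin.last k)
        simp only [Fin.val_last, Nat.add_sub_cancel, if_true] at hl
        rw [hl]
        refine ⟨fun l => ?_, hu⟩
        rw [h l]
        split_ifs
        · simp
        · simpa using hw l

theorem BerS_anti (n : ℕ) : ∀ m r, BerS n (r + 1) m ≤ BerS n r m := by
  intro m
  induction m with
  | zero => intro r; cases r <;> simp [BerS]
  | succ m ih =>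
    intro r v hv
    rw [mem_BerS] at hv
    cases r with
    | zero =>
      have h := ih 0 hv.2
      have : totL n m (sumL n m v) = 0 := by
        cases m with
        | zero => simp only [BerS, Submodule.mem_bot] at h; simp [h]
        | succ m => simpa [BerS] using h
      rw [totL_sumL] at this
      simpa [BerS] using this
    | succ r =>
      rw [mem_BerS]
      exact ⟨fun l => ih _ (hv.1 l), ih _ hv.2⟩

theorem BerS_rec (k r m : ℕ) : Module.finrank (ZMod 2) (BerS (k + 1) (r + 1) (m + 1)) =
    k * Module.finrank (ZMod 2) (BerS (k + 1) r m) +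
      Module.finrank (ZMod 2) (BerS (k + 1) (r + 1) m) := by
  let f : BerS (k + 1) (r + 1) (m + 1) →ₗ[ZMod 2]
      (Fin k → BerS (k + 1) r m) × BerS (k + 1) (r + 1) m :=
    LinearMap.prod
      (LinearMap.pi fun i => (blockL (k + 1) m i.castSucc).restrict
        (fun v hv => (mem_BerS.1 hv).1 i.castSucc))
      ((sumL (k + 1) m).restrict (fun v hv => (mem_BerS.1 hv).2))
  have hf : Function.Bijective f := by
    constructor
    · rintro ⟨v, hv⟩ ⟨w, hw⟩ h
      have h1 : ∀ i : Fin k, blockL (k + 1) m i.castSucc v = blockL (k + 1) m i.castSucc w :=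
        fun i => congrArg Subtype.val (congrFun (congrArg Prod.fst h) i)
      have h2 : sumL (k + 1) m v = sumL (k + 1) m w :=
        congrArg Subtype.val (congrArg Prod.snd h)
      rw [sumL_apply, sumL_apply, Fin.sum_univ_castSucc, Fin.sum_univ_castSucc,
        Finset.sum_congr rfl (fun i _ => h1 i)] at h2
      apply Subtype.ext
      apply block_ext
      intro l
      induction l using Fin.lastCases with
      | last => exact add_left_cancel h2
      | cast i => exact h1 i
    · rintro ⟨b, s⟩
      let c : Fin (k + 1) → ((Fin m → Fin (k + 1)) → ZMod 2) :=
        Fin.snoc (α := fun _ => (Fin m → Fin (k + 1)) → ZMod 2)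
          (fun i => (b i : (Fin m → Fin (k + 1)) → ZMod 2)) (s.1 - ∑ i, (b i).1)
      have hc1 : ∀ i : Fin k, c i.castSucc = b i := fun i => by simp [c]
      have hc2 : c (Fin.last k) = s.1 - ∑ i, (b i).1 := by simp [c]
      have hs : sumL (k + 1) m (glue (k + 1) m c) = s := by
        rw [sumL_apply, Fin.sum_univ_castSucc]
        simp only [block_glue, hc1, hc2]
        abel
      refine ⟨⟨glue (k + 1) m c, mem_BerS.2 ⟨fun l => ?_, ?_⟩⟩, ?_⟩
      · rw [block_glue]
        induction l using Fin.lastCases with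
        | last =>
          rw [hc2]
          exact Submodule.sub_mem _ (BerS_anti _ _ _ s.2)
            (Submodule.sum_mem _ fun i _ => (b i).2)
        | cast i => rw [hc1]; exact (b i).2
      · rw [hs]; exact s.2
      · refine Prod.ext (funext fun i => Subtype.ext ?_) (Subtype.ext hs)
        exact (block_glue _ _ _ _).trans (hc1 i)
  rw [(LinearEquiv.ofBijective f hf).finrank_eq, Module.finrank_prod, Module.finrank_pi_fintype]
  simp

theorem DBerS_rec (k r m : ℕ) : Module.finrank (ZMod 2) (DBerS k (r + 1) (m + 1)) =
    k * Module.finrank (ZMod 2) (DBerS k r m) +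
      Module.finrank (ZMod 2) (DBerS k (r + 1) m) := by
  let f : DBerS k (r + 1) (m + 1) →ₗ[ZMod 2]
      (Fin k → DBerS k r m) × DBerS k (r + 1) m :=
    LinearMap.prod
      (LinearMap.pi fun i =>
        (blockL (k + 1) m i.castSucc - blockL (k + 1) m (Fin.last k)).restrict
        (fun v hv => (mem_DBerS.1 hv).1 i.castSucc))
      ((blockL (k + 1) m (Fin.last k)).restrict (fun v hv => (mem_DBerS.1 hv).2))
  have hf : Function.Bijective f := by
    constructor
    · rintro ⟨v, hv⟩ ⟨w, hw⟩ h
      have h1 : ∀ i : Fin k, blockL (k + 1) m i.castSucc v - blockL (k + 1) m (Fin.last k) v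
          = blockL (k + 1) m i.castSucc w - blockL (k + 1) m (Fin.last k) w :=
        fun i => congrArg Subtype.val (congrFun (congrArg Prod.fst h) i)
      have h2 : blockL (k + 1) m (Fin.last k) v = blockL (k + 1) m (Fin.last k) w :=
        congrArg Subtype.val (congrArg Prod.snd h)
      apply Subtype.ext
      apply block_ext
      intro l
      induction l using Fin.lastCases with
      | last => exact h2
      | cast i =>
        have := h1 i
        rw [h2] at this
        exact sub_left_injective this
    · rintro ⟨b, s⟩
      let c : Fin (k + 1) → ((Fin m → Fin (k + 1)) → ZMod 2) :=
        Fin.snoc (α := fun _ => (Fin m → Fin (k + 1)) → ZMod 2)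
          (fun i => (b i : (Fin m → Fin (k + 1)) → ZMod 2) + s.1) s.1
      have hc1 : ∀ i : Fin k, c i.castSucc = b i + s.1 := fun i => by simp [c]
      have hc2 : c (Fin.last k) = s.1 := by simp [c]
      refine ⟨⟨glue (k + 1) m c, mem_DBerS.2 ⟨fun l => ?_, ?_⟩⟩, ?_⟩
      · rw [block_glue, block_glue, hc2]
        induction l using Fin.lastCases with
        | last => rw [hc2, sub_self]; exact Submodule.zero_mem _
        | cast i => rw [hc1, add_sub_cancel_right]; exact (b i).2
      · rw [block_glue, hc2]; exact s.2
      · refine Prod.ext (funext fun i => Subtype.ext ?_)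
          (Subtype.ext ((block_glue _ _ _ _).trans hc2))
        change blockL (k + 1) m i.castSucc (glue (k + 1) m c)
          - blockL (k + 1) m (Fin.last k) (glue (k + 1) m c) = _
        rw [block_glue, block_glue, hc1, hc2, add_sub_cancel_right]
  rw [(LinearEquiv.ofBijective f hf).finrank_eq, Module.finrank_prod, Module.finrank_pi_fintype]
  simp

/-- partial binomial sum -/
def pbs (k r m : ℕ) : ℕ := ∑ w ∈ Finset.range (r + 1), m.choose w * k ^ w

theorem pbs_rec (k r m : ℕ) : pbs k (r + 1) (m + 1) = k * pbs k r m + pbs k (r + 1) m := by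
  unfold pbs
  rw [Finset.sum_range_succ', Finset.sum_range_succ' _ (r + 1), Finset.mul_sum, ← add_assoc,
    ← Finset.sum_add_distrib]
  congr 1
  · refine Finset.sum_congr rfl fun w _ => ?_
    rw [Nat.choose_succ_succ]; ring
  · simp

theorem pbs_zero_left (k m : ℕ) : pbs k 0 m = 1 := by simp [pbs]

theorem pbs_zero_right (k r : ℕ) : pbs k r 0 = 1 := by
  unfold pbs
  rw [Finset.sum_range_succ']
  simp

theorem DBerS_dim (k : ℕ) : ∀ m r, Module.finrank (ZMod 2) (DBerS k r m) = pbs k r m := by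
  intro m
  induction m with
  | zero =>
    intro r
    rw [pbs_zero_right]
    have h : DBerS k r 0 = ⊤ := by cases r <;> rfl
    rw [h, finrank_top]; simp
  | succ m ih =>
    intro r
    cases r with
    | zero =>
      rw [pbs_zero_left, DBerS]
      exact finrank_span_singleton (fun h => one_ne_zero (congrFun h (fun _ => 0)))
    | succ r => rw [DBerS_rec, ih, ih, pbs_rec]

theorem BerS_dim (k : ℕ) : ∀ m r,
    Module.finrank (ZMod 2) (BerS (k + 1) r m) + pbs k r m = (k + 1) ^ m := by
  intro m
  induction m with
  | zero =>
    intro r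
    rw [pbs_zero_right]
    have h : BerS (k + 1) r 0 = ⊥ := by cases r <;> rfl
    rw [h, finrank_bot]; simp
  | succ m ih =>
    intro r
    cases r with
    | zero =>
      rw [pbs_zero_left, BerS]
      have h := LinearMap.finrank_range_add_finrank_ker (totL (k + 1) (m + 1))
      have hs : LinearMap.range (totL (k + 1) (m + 1)) = ⊤ := by
        rw [LinearMap.range_eq_top]
        intro a
        exact ⟨Pi.single 0 a, by simp [totL_apply]⟩
      rw [hs, finrank_top] at h
      simp only [Module.finrank_self, Module.finrank_fintype_fun_eq_card, Fintype.card_pi,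
        Fintype.card_fin, Finset.prod_const, Finset.card_univ] at h
      rw [← h, add_comm]
    | succ r =>
      have h1 := ih r
      have h2 := ih (r + 1)
      rw [BerS_rec, pbs_rec, pow_succ]
      linear_combination k * h1 + h2

/-- `dim Ber_n^r(m) = Σ_{w=r+1}^m C(m,w)(n-1)^w` and
`dim B_n^r(m) = Σ_{w=0}^r C(m,w)(n-1)^w`. -/
theorem stmt6 (n m r : ℕ) (hn : 2 ≤ n) (hr : r ≤ m) :
    Module.finrank (ZMod 2) (Submodule.span (ZMod 2) (Ber n r m)) =
      ∑ w ∈ Finset.Icc (r + 1) m, m.choose w * (n - 1) ^ w ∧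
    Module.finrank (ZMod 2) (Submodule.span (ZMod 2) (DBer n r m)) =
      ∑ w ∈ Finset.Icc 0 r, m.choose w * (n - 1) ^ w := by
  obtain ⟨k, rfl⟩ : ∃ k, n = k + 1 := ⟨n - 1, by omega⟩
  rw [← BerS_coe, ← DBerS_coe, Submodule.span_eq, Submodule.span_eq, DBerS_dim,
    Nat.add_sub_cancel]
  constructor
  · have h := BerS_dim k m r
    have h2 : pbs k r m + ∑ w ∈ Finset.Icc (r + 1) m, m.choose w * k ^ w = (k + 1) ^ m := by
      have hI : Finset.Icc (r + 1) m = Finset.Ico (r + 1) (m + 1) := by ext; simp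
      rw [hI, pbs, Finset.sum_range_add_sum_Ico _ (by omega), add_pow]
      refine Finset.sum_congr rfl fun w _ => ?_
      simp [mul_comm]
    omega
  · unfold pbs
    refine Finset.sum_congr ?_ fun _ _ => rfl
    ext; simp
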